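/- Let n > 0 be an integer and {ξ_k}_{k≥0} a sequence of positive real numbers. Suppose there exist k0 > 0, real numbers A_1, A_2, A_3 > 0, α > β > 0, α > γ > 0 and ε > 0 such that: (i) ξ_1 ≤ exp(−α·∑_{i=1}^n 1/(k0+i))·ξ_0 + A_1, and (ii) for every integer k ≥ 1, ξ_{k+1} ≤ exp(−α·∑_{i=1}^n 1/(k0+nk+i) + ε/k²)·ξ_k + A_2/(k0+n(k+1))^{β+1} + A_3/(k0+n(k+1))^{γ+1}. Then for every integer K ≥ 1, with c := e^{επ²/6}, ξ_K ≤ c(k0+1)^α/(k0+nK)^α·ξ_0 + c(k0+n+1)^α·A_1/(k0+nK)^α + (c/(α−β))·e^{α/(k0+n+1)}·A_2/(n(k0+nK)^β) + c·e^{α/(k0+n+1)}·A_2/(k0+nK)^{β+1} + (c/(α−γ))·e^{α/(k0+n+1)}·A_3/(n(k0+nK)^γ) + c·e^{α/(k0+n+1)}·A_3/(k0+nK)^{γ+1}. -/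

import Mathlib

open Finset

theorem rpow_add_one_le_exp_div_mul_rpow {z α : ℝ} (hz : 0 < z) (hα : 0 ≤ α) :
    (z + 1) ^ α ≤ Real.exp (α / z) * z ^ α := by
  have h : z + 1 ≤ Real.exp (1 / z) * z := by
    have := mul_le_mul_of_nonneg_right (Real.add_one_le_exp (1 / z)) hz.le
    rwa [add_mul, one_div_mul_cancel hz.ne', one_mul, add_comm] at this
  calc (z + 1) ^ α ≤ (Real.exp (1 / z) * z) ^ α := by gcongr
    _ = Real.exp (α / z) * z ^ α := by
      rw [Real.mul_rpow (Real.exp_pos _).le hz.le, ← Real.exp_mul, one_div_mul_eq_div]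

theorem exp_neg_mul_sum_mul_rpow_le {y α : ℝ} (hy : 0 < y) (hα : 0 ≤ α) (n : ℕ) :
    Real.exp (-(α * ∑ i ∈ Icc 1 n, 1 / (y + i))) * (y + n + 1) ^ α ≤ (y + 1) ^ α := by
  induction n with
  | zero => simp
  | succ n ih =>
    refine le_trans ?_ ih
    have hz : 0 < y + n + 1 := by positivity
    rw [sum_Icc_succ_top (by omega), mul_add, neg_add, Real.exp_add, mul_assoc]
    push_cast
    rw [← add_assoc, mul_one_div, Real.exp_neg (α / _)]
    gcongr
    rw [inv_mul_le_iff₀ (Real.exp_pos _)]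
    exact rpow_add_one_le_exp_div_mul_rpow hz hα

/-- For `p ≥ 1`, the tangent of `x ↦ x ^ p` at the left endpoint lies below the secant. -/
theorem mul_rpow_sub_one_le_rpow_add_sub {x d p : ℝ} (hx : 0 < x) (hd : 0 ≤ d) (hp : 1 ≤ p) :
    d * p * x ^ (p - 1) ≤ (x + d) ^ p - x ^ p := by
  have hdx : 0 ≤ d / x := by positivity
  have h := mul_le_mul_of_nonneg_left
    (one_add_mul_self_le_rpow_one_add (by linarith : -1 ≤ d / x) hp) (Real.rpow_nonneg hx.le p)
  rw [← Real.mul_rpow hx.le (by positivity), mul_add, mul_one, mul_add, mul_div_cancel₀ _ hx.ne',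
    mul_one] at h
  rw [Real.rpow_sub_one hx.ne']
  calc d * p * (x ^ p / x) = x ^ p * (p * (d / x)) := by ring
    _ ≤ _ := by linarith

/-- For `0 ≤ p ≤ 1`, the tangent of `x ↦ x ^ p` at the right endpoint lies above the graph. -/
theorem mul_rpow_add_sub_one_le_rpow_add_sub {x d p : ℝ} (hx : 0 < x) (hd : 0 ≤ d) (hp : 0 ≤ p)
    (hp' : p ≤ 1) :
    d * p * (x + d) ^ (p - 1) ≤ (x + d) ^ p - x ^ p := by
  have hxd : 0 < x + d := by positivity
  have hdx : d / (x + d) ≤ 1 := by rw [div_le_one hxd]; linarith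
  have h := mul_le_mul_of_nonneg_left
    (rpow_one_add_le_one_add_mul_self (by linarith : -1 ≤ -(d / (x + d))) hp hp')
    (Real.rpow_nonneg hxd.le p)
  have hx' : (x + d) * (1 + -(d / (x + d))) = x := by field_simp; ring
  rw [← Real.mul_rpow hxd.le (by linarith), hx'] at h
  rw [Real.rpow_sub_one hxd.ne']
  have : d * p * ((x + d) ^ p / (x + d)) = (x + d) ^ p * (p * (d / (x + d))) := by ring
  linarith

theorem sum_rpow_sub_one_le {a d p : ℝ} (ha : 0 < a) (hd : 0 < d) (hp : 0 < p) {K : ℕ}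
    (hK : 1 ≤ K) :
    ∑ j ∈ Ico 1 K, (a + d * (j + 1)) ^ (p - 1) ≤
      (a + d * K) ^ p / (d * p) + (a + d * K) ^ (p - 1) := by
  have hdp : 0 < d * p := by positivity
  have hpos (k : ℕ) : 0 < a + d * k := by positivity
  rcases le_total 1 p with h | h
  · induction K, hK using Nat.le_induction with
    | base =>
      have := hpos 1
      simp only [Ico_self, sum_empty]
      positivity
    | succ k hk ih =>
      have hs := mul_rpow_sub_one_le_rpow_add_sub (hpos k) hd.le h
      rw [← le_div_iff₀' hdp, sub_div] at hs
      rw [sum_Ico_succ_top hk]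
      push_cast
      rw [show a + d * (k + 1) = a + d * k + d by ring]
      linarith
  · suffices hS : ∑ j ∈ Ico 1 K, (a + d * (j + 1)) ^ (p - 1) ≤ (a + d * K) ^ p / (d * p) by
      linarith [Real.rpow_nonneg (hpos K).le (p - 1)]
    induction K, hK using Nat.le_induction with
    | base =>
      have := hpos 1
      simp only [Ico_self, sum_empty]
      positivity
    | succ k hk ih =>
      have hs := mul_rpow_add_sub_one_le_rpow_add_sub (hpos k) hd.le hp.le h
      rw [← le_div_iff₀' hdp, sub_div] at hs
      rw [sum_Ico_succ_top hk]
      push_cast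
      rw [show a + d * (k + 1) = a + d * k + d by ring]
      linarith

/-- A discrete Grönwall inequality with multipliers `exp (u k) ≥ 1`. -/
theorem le_exp_sum_mul_add_sum {η u b : ℕ → ℝ} {M : ℝ} (hu : ∀ k, 0 ≤ u k) (hb : ∀ k, 0 ≤ b k)
    (h1 : η 1 ≤ M) (hrec : ∀ k, 1 ≤ k → η (k + 1) ≤ Real.exp (u k) * η k + b k) {K : ℕ}
    (hK : 1 ≤ K) :
    η K ≤ Real.exp (∑ j ∈ Ico 1 K, u j) * (M + ∑ j ∈ Ico 1 K, b j) := by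
  induction K, hK using Nat.le_induction with
  | base => simpa using h1
  | succ k hk ih =>
    rw [sum_Ico_succ_top hk, sum_Ico_succ_top hk, Real.exp_add]
    have hE : 1 ≤ Real.exp (∑ j ∈ Ico 1 k, u j) * Real.exp (u k) := by
      rw [← Real.exp_add]
      exact Real.one_le_exp (add_nonneg (sum_nonneg fun j _ => hu j) (hu k))
    have h := mul_le_mul_of_nonneg_left ih (Real.exp_pos (u k)).le
    have h' := mul_le_mul_of_nonneg_right hE (hb k)
    linarith [hrec k hk]

theorem sum_Ico_one_div_sq_le (K : ℕ) :
    ∑ j ∈ Ico 1 K, 1 / (j : ℝ) ^ 2 ≤ Real.pi ^ 2 / 6 :=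
  sum_le_hasSum _ (fun _ _ => by positivity) hasSum_zeta_two

theorem rpow_add_one_mul_div_rpow_le {z z₀ α β : ℝ} (hz₀ : 0 < z₀) (hz : z₀ ≤ z) (hα : 0 ≤ α) :
    (z + 1) ^ α / z ^ (β + 1) ≤ Real.exp (α / z₀) * z ^ (α - β - 1) := by
  have hzpos : 0 < z := hz₀.trans_le hz
  rw [div_le_iff₀ (by positivity), mul_assoc, ← Real.rpow_add hzpos,
    show α - β - 1 + (β + 1) = α by ring]
  refine (rpow_add_one_le_exp_div_mul_rpow hzpos hα).trans ?_
  gcongr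

/-- **The two-parameter variant of Chung's lemma with two inhomogeneous decaying terms.** -/
theorem chung_variant_two_terms (n : ℕ) (hn : 0 < n) (ξ : ℕ → ℝ) (hξ : ∀ k, 0 < ξ k)
    (k0 A₁ A₂ A₃ α β γ ε : ℝ) (hk0 : 0 < k0) (hA₁ : 0 < A₁) (hA₂ : 0 < A₂) (hA₃ : 0 < A₃)
    (hβ : 0 < β) (hβα : β < α) (hγ : 0 < γ) (hγα : γ < α) (hε : 0 < ε)
    (h1 : ξ 1 ≤ Real.exp (-(α * ∑ i ∈ Finset.Icc 1 n, 1 / (k0 + i))) * ξ 0 + A₁)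
    (hrec : ∀ k : ℕ, 1 ≤ k →
      ξ (k + 1) ≤ Real.exp (-(α * ∑ i ∈ Finset.Icc 1 n, 1 / (k0 + n * k + i)) + ε / k ^ 2) * ξ k
          + A₂ / (k0 + n * (k + 1)) ^ (β + 1) + A₃ / (k0 + n * (k + 1)) ^ (γ + 1)) :
    ∀ K : ℕ, 1 ≤ K →
      ξ K ≤ Real.exp (ε * Real.pi ^ 2 / 6) * (k0 + 1) ^ α / (k0 + n * K) ^ α * ξ 0
          + Real.exp (ε * Real.pi ^ 2 / 6) * (k0 + n + 1) ^ α * A₁ / (k0 + n * K) ^ α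
          + (Real.exp (ε * Real.pi ^ 2 / 6) / (α - β)) * Real.exp (α / (k0 + n + 1)) * A₂
              / (n * (k0 + n * K) ^ β)
          + Real.exp (ε * Real.pi ^ 2 / 6) * Real.exp (α / (k0 + n + 1)) * A₂
              / (k0 + n * K) ^ (β + 1)
          + (Real.exp (ε * Real.pi ^ 2 / 6) / (α - γ)) * Real.exp (α / (k0 + n + 1)) * A₃
              / (n * (k0 + n * K) ^ γ)
          + Real.exp (ε * Real.pi ^ 2 / 6) * Real.exp (α / (k0 + n + 1)) * A₃
              / (k0 + n * K) ^ (γ + 1) := by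
  intro K hK
  have hα : 0 < α := hβ.trans hβα
  have hn' : (1 : ℝ) ≤ n := by exact_mod_cast hn
  have hn0 : (0 : ℝ) < n := by linarith
  set D := Real.exp (α / (k0 + n + 1))
  have hpos (k : ℕ) : 0 < k0 + n * k := by positivity
  let b : ℕ → ℝ := fun k => D * A₂ * (k0 + n * (k + 1)) ^ (α - β - 1)
    + D * A₃ * (k0 + n * (k + 1)) ^ (α - γ - 1)
  have hb (k : ℕ) : 0 ≤ b k := by positivity
  have hstart : ξ 1 * (k0 + n * (1 : ℕ) + 1) ^ α ≤
      (k0 + 1) ^ α * ξ 0 + (k0 + n + 1) ^ α * A₁ := by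
    rw [Nat.cast_one, mul_one]
    have hP : 0 ≤ (k0 + n + 1) ^ α := by positivity
    have h := mul_le_mul_of_nonneg_right h1 hP
    have h' := mul_le_mul_of_nonneg_right (exp_neg_mul_sum_mul_rpow_le hk0 hα.le n) (hξ 0).le
    linarith
  have hstep (k : ℕ) (hk : 1 ≤ k) : ξ (k + 1) * (k0 + n * (k + 1 : ℕ) + 1) ^ α ≤
      Real.exp (ε * (1 / (k : ℝ) ^ 2)) * (ξ k * (k0 + n * k + 1) ^ α) + b k := by
    push_cast
    have hk' : (1 : ℝ) ≤ k := by exact_mod_cast hk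
    have hz : k0 + n + 1 ≤ k0 + n * (k + 1) := by nlinarith
    have hz₀ : 0 < k0 + n + 1 := by positivity
    have hP : 0 ≤ (k0 + n * (k + 1) + 1) ^ α := by positivity
    have h := mul_le_mul_of_nonneg_right (hrec k hk) hP
    have hc := mul_le_mul_of_nonneg_left (exp_neg_mul_sum_mul_rpow_le (hpos k) hα.le n)
      (mul_pos (Real.exp_pos (ε / (k : ℝ) ^ 2)) (hξ k)).le
    have h₂ := mul_le_mul_of_nonneg_left
      (rpow_add_one_mul_div_rpow_le (β := β) hz₀ hz hα.le) hA₂.le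
    have h₃ := mul_le_mul_of_nonneg_left
      (rpow_add_one_mul_div_rpow_le (β := γ) hz₀ hz hα.le) hA₃.le
    rw [show k0 + n * (k : ℝ) + n + 1 = k0 + n * (k + 1) + 1 by ring] at hc
    rw [Real.exp_add] at h
    rw [mul_one_div]
    simp only [b]
    calc _ ≤ _ := h
      _ = Real.exp (ε / (k : ℝ) ^ 2) * ξ k *
            (Real.exp (-(α * ∑ i ∈ Icc 1 n, 1 / (k0 + n * k + i))) * (k0 + n * (k + 1) + 1) ^ α)
          + A₂ * ((k0 + n * (k + 1) + 1) ^ α / (k0 + n * (k + 1)) ^ (β + 1))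
          + A₃ * ((k0 + n * (k + 1) + 1) ^ α / (k0 + n * (k + 1)) ^ (γ + 1)) := by ring
      _ ≤ _ := by linarith
  have hmain := le_exp_sum_mul_add_sum (η := fun k => ξ k * (k0 + n * k + 1) ^ α)
    (fun k => by positivity) hb hstart hstep hK
  have hx := hpos K
  set x := k0 + n * (K : ℝ)
  have hexp : Real.exp (∑ j ∈ Ico 1 K, ε * (1 / (j : ℝ) ^ 2)) ≤
      Real.exp (ε * Real.pi ^ 2 / 6) := by
    rw [← mul_sum, mul_div_assoc]
    gcongr
    exact sum_Ico_one_div_sq_le K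
  set c := Real.exp (ε * Real.pi ^ 2 / 6)
  have hsum : ∑ j ∈ Ico 1 K, b j ≤
      D * A₂ * (x ^ (α - β) / (n * (α - β)) + x ^ (α - β - 1))
        + D * A₃ * (x ^ (α - γ) / (n * (α - γ)) + x ^ (α - γ - 1)) := by
    simp only [b]
    rw [sum_add_distrib, ← mul_sum, ← mul_sum]
    gcongr
    · exact sum_rpow_sub_one_le hk0 hn0 (sub_pos.2 hβα) hK
    · exact sum_rpow_sub_one_le hk0 hn0 (sub_pos.2 hγα) hK
  have hξ0 := hξ 0
  have hξK : ξ K ≤ c * ((k0 + 1) ^ α * ξ 0 + (k0 + n + 1) ^ α * A₁ +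
      (D * A₂ * (x ^ (α - β) / (n * (α - β)) + x ^ (α - β - 1))
        + D * A₃ * (x ^ (α - γ) / (n * (α - γ)) + x ^ (α - γ - 1)))) / x ^ α := by
    rw [le_div_iff₀ (by positivity)]
    calc ξ K * x ^ α ≤ ξ K * (x + 1) ^ α := by
          have := (hξ K).le
          gcongr
          linarith
      _ ≤ _ := hmain
      _ ≤ _ := by gcongr
  refine hξK.trans_eq ?_
  have hβ' : α - β ≠ 0 := (sub_pos.2 hβα).ne'
  have hγ' : α - γ ≠ 0 := (sub_pos.2 hγα).ne'
  rw [Real.rpow_sub_one hx.ne', Real.rpow_sub_one hx.ne', Real.rpow_sub hx, Real.rpow_sub hx,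
    Real.rpow_add_one hx.ne', Real.rpow_add_one hx.ne']
  field_simp
  ring
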